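/- arXiv:1611.04509 — 2 statements merged into one kernel-verified Lean document; each statement's English description precedes it below -/
import Mathlib

section
/- Let (X, ‖·‖_X) and (Y, ‖·‖_Y) be two real normed linear spaces of the same finite dimension, let x_u ∈ X, r₁ > 0, and let F : X → Y be a mapping that is continuous on the open ball B_X(x_u, r₁) = {x ∈ X : ‖x − x_u‖_X < r₁}. Suppose there exist constants S > 0 and r₂ > 0 such that ‖x₁ − x₂‖_X ≤ S·‖F(x₁) − F(x₂)‖_Y for every x₁, x₂ ∈ B_X(x_u, r₁) satisfying ‖F(x_j) − F(x_u)‖_Y ≤ r₂ for j = 1, 2. Then, setting r₀ = min(r₂, r₁/S), there exists a map G defined on the open ball B_Y(F(x_u), r₀) = {y ∈ Y : ‖y − F(x_u)‖_Y < r₀} with values in B_X(x_u, r₁) such that F(G(y)) = y for every y ∈ B_Y(F(x_u), r₀), and G is Lipschitz-continuous with Lipschitz constant S, i.e. ‖G(y₁) − G(y₂)‖_X ≤ S·‖y₁ − y₂‖_Y for all y₁, y₂ ∈ B_Y(F(x_u), r₀). -/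
open MeasureTheory Set Filter Topology Metric
open scoped NNReal

namespace StetterAux

variable {E : Type*} [NormedAddCommGroup E] [InnerProductSpace ℝ E] [FiniteDimensional ℝ E]

/-- `det (1 + A)` is a fixed linear combination of the `det (1 + tᵢ A)`. -/
lemma det_interp (v : ℕ → ℝ) (hv : Function.Injective v) (A : E →L[ℝ] E) :
    (ContinuousLinearMap.id ℝ E + A).det =
      ∑ i ∈ Finset.range (Module.finrank ℝ E + 1),
        (Lagrange.basis (Finset.range (Module.finrank ℝ E + 1)) v i).eval 1 *
          (ContinuousLinearMap.id ℝ E + v i • A).det := by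
  classical
  let b := Module.finBasis ℝ E
  let M := LinearMap.toMatrix b b (A : E →ₗ[ℝ] E)
  let p : Polynomial ℝ := Matrix.det ((Polynomial.X : Polynomial ℝ) • M.map Polynomial.C +
    (1 : Matrix _ _ ℝ).map Polynomial.C)
  have hp : ∀ t : ℝ, p.eval t = (ContinuousLinearMap.id ℝ E + t • A).det := by
    intro t
    have h1 : (ContinuousLinearMap.id ℝ E + t • A).det = (1 + t • M).det := by
      rw [ContinuousLinearMap.det, ← LinearMap.det_toMatrix b]
      congr 1
      simp [M]
    rw [h1]
    simp only [p]
    rw [← Polynomial.coe_evalRingHom, RingHom.map_det]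
    congr 1
    ext i j
    simp [Matrix.one_apply, apply_ite, add_comm]
    ring
  have hdeg : p.degree < (Finset.range (Module.finrank ℝ E + 1)).card := by
    have := Polynomial.natDegree_det_X_add_C_le M 1
    refine lt_of_le_of_lt Polynomial.degree_le_natDegree ?_
    simp only [Fintype.card_fin, Finset.card_range] at this ⊢
    exact_mod_cast Nat.lt_succ_of_le this
  have key := congrArg (Polynomial.eval 1)
    (Lagrange.eq_interpolate (v := v) (hv.injOn) hdeg)
  rw [hp 1, Lagrange.interpolate_apply, Polynomial.eval_finsetSum] at key
  simp only [one_smul, Polynomial.eval_mul, Polynomial.eval_C, hp] at key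
  rw [key]
  exact Finset.sum_congr rfl fun i _ => mul_comm _ _

lemma det_pos_of_small (A : E →L[ℝ] E) (c : ℝ) (hc : c < 1) (hA : ∀ v, ‖A v‖ ≤ c * ‖v‖) :
    0 < (ContinuousLinearMap.id ℝ E + A).det := by
  have hne : ∀ s ∈ Icc (0:ℝ) 1, (ContinuousLinearMap.id ℝ E + s • A).det ≠ 0 := by
    intro s hs h0
    have h1 : LinearMap.det ((ContinuousLinearMap.id ℝ E + s • A : E →L[ℝ] E) : E →ₗ[ℝ] E) = 0 := h0
    have h2 := LinearMap.bot_lt_ker_of_det_eq_zero h1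
    obtain ⟨v, hv, hv0⟩ := (Submodule.ne_bot_iff _).1 h2.ne'
    have hv1 : v + s • A v = 0 := by simpa using hv
    have hv2 : v = -(s • A v) := eq_neg_of_add_eq_zero_left hv1
    have h3 : ‖v‖ = s * ‖A v‖ := by
      conv_lhs => rw [hv2]
      rw [norm_neg, norm_smul, Real.norm_of_nonneg hs.1]
    have h4 : 0 < ‖v‖ := norm_pos_iff.2 hv0
    have := hA v
    nlinarith [hs.1, hs.2, norm_nonneg (A v)]
  by_contra hneg
  push Not at hneg
  have hcont : ContinuousOn (fun s : ℝ => (ContinuousLinearMap.id ℝ E + s • A).det) (Icc 0 1) := by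
    apply Continuous.continuousOn
    exact ContinuousLinearMap.continuous_det.comp (by fun_prop)
  have hiv := intermediate_value_Icc' (zero_le_one' ℝ) hcont
  have : (0:ℝ) ∈ Icc ((fun s : ℝ => (ContinuousLinearMap.id ℝ E + s • A).det) 1)
      ((fun s : ℝ => (ContinuousLinearMap.id ℝ E + s • A).det) 0) := by
    refine ⟨by simpa using hneg, ?_⟩
    simp [ContinuousLinearMap.det]
  obtain ⟨s, hs, h⟩ := hiv this
  exact hne s hs h

variable [MeasurableSpace E] [BorelSpace E]

lemma small_t (μ : Measure E) [μ.IsAddHaarMeasure] (g : E → E) (K : ℝ≥0) (hg : LipschitzWith K g)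
    (hout : ∀ x, 1 ≤ ‖x‖ → g x = 0) (hd : ∀ x ∈ ball (0:E) 1, DifferentiableAt ℝ g x)
    (t : ℝ) (ht0 : 0 ≤ t) (ht : t * K < 1) :
    IntegrableOn (fun x => (ContinuousLinearMap.id ℝ E + t • fderiv ℝ g x).det) (ball 0 1) μ ∧
    ∫ x in ball (0:E) 1, (ContinuousLinearMap.id ℝ E + t • fderiv ℝ g x).det ∂μ
      = μ.real (ball 0 1) := by
  let f : E → E := fun x => x + t • g x
  have happ : ApproximatesLinearOn f ((ContinuousLinearEquiv.refl ℝ E : E ≃L[ℝ] E) : E →L[ℝ] E)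
      univ (t.toNNReal * K) := by
    intro x _ y _
    have : f x - f y - (x - y) = t • (g x - g y) := by simp only [f, smul_sub]; abel
    simp only [ContinuousLinearEquiv.coe_refl, ContinuousLinearMap.coe_id', id, this, norm_smul,
      Real.norm_of_nonneg ht0]
    have := hg.norm_sub_le x y
    have := mul_le_mul_of_nonneg_left this ht0
    rw [NNReal.coe_mul, Real.coe_toNNReal t ht0, mul_assoc]
    exact this
  have hc : Subsingleton E ∨ (t.toNNReal * K : ℝ≥0) <
      ‖((ContinuousLinearEquiv.refl ℝ E).symm : E →L[ℝ] E)‖₊⁻¹ := by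
    rcases subsingleton_or_nontrivial E with h | h
    · exact Or.inl h
    · right
      have : ‖((ContinuousLinearEquiv.refl ℝ E).symm : E →L[ℝ] E)‖₊ = 1 := by
        ext; simp
      rw [this, inv_one, ← NNReal.coe_lt_coe, NNReal.coe_mul, Real.coe_toNNReal t ht0]
      exact ht
  have hinj : Function.Injective f := injOn_univ.1 (happ.injOn hc)
  have hsurj := happ.surjective hc
  have hfo : ∀ x, 1 ≤ ‖x‖ → f x = x := by intro x hx; simp [f, hout x hx]
  have himg : f '' ball 0 1 = ball 0 1 := by
    apply Subset.antisymm
    · rintro _ ⟨x, hx, rfl⟩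
      by_contra h
      have h1 : 1 ≤ ‖f x‖ := by simpa using h
      have h2 := hinj (hfo _ h1)
      rw [h2] at h1
      simp at hx; linarith
    · intro y hy
      obtain ⟨x, rfl⟩ := hsurj y
      refine ⟨x, ?_, rfl⟩
      by_contra h
      have h1 : 1 ≤ ‖x‖ := by simpa using h
      rw [hfo x h1] at hy
      exact h hy
  have hder : ∀ x ∈ ball (0:E) 1, HasFDerivWithinAt f
      (ContinuousLinearMap.id ℝ E + t • fderiv ℝ g x) (ball 0 1) x := by
    intro x hx
    exact ((hasFDerivAt_id x).add ((hd x hx).hasFDerivAt.const_smul t)).hasFDerivWithinAt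
  have hpos : ∀ x, 0 < (ContinuousLinearMap.id ℝ E + t • fderiv ℝ g x).det := by
    intro x
    apply det_pos_of_small _ (t * K) ht
    intro v
    rw [_root_.smul_apply, norm_smul, Real.norm_of_nonneg ht0, mul_assoc]
    gcongr
    refine (ContinuousLinearMap.le_opNorm _ _).trans ?_
    gcongr
    exact norm_fderiv_le_of_lipschitz ℝ hg
  have habs : ∀ x, |(ContinuousLinearMap.id ℝ E + t • fderiv ℝ g x).det| • (1:ℝ) =
      (ContinuousLinearMap.id ℝ E + t • fderiv ℝ g x).det := by
    intro x; rw [abs_of_pos (hpos x)]; simp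
  constructor
  · have := (integrableOn_image_iff_integrableOn_abs_det_fderiv_smul μ measurableSet_ball hder
      hinj.injOn (fun _ => (1:ℝ))).1 (by
        rw [himg]; exact integrableOn_const (measure_ball_lt_top.ne))
    simpa only [habs] using this
  · have := integral_image_eq_integral_abs_det_fderiv_smul μ measurableSet_ball hder
      hinj.injOn (fun _ => (1:ℝ))
    simp only [habs, himg] at this
    rw [← this]; simp

lemma volume_identity (μ : Measure E) [μ.IsAddHaarMeasure] (g : E → E) (K : ℝ≥0)
    (hg : LipschitzWith K g)
    (hout : ∀ x, 1 ≤ ‖x‖ → g x = 0) (hd : ∀ x ∈ ball (0:E) 1, DifferentiableAt ℝ g x) :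
    ∫ x in ball (0:E) 1, (ContinuousLinearMap.id ℝ E + fderiv ℝ g x).det ∂μ
      = μ.real (ball 0 1) := by
  let v : ℕ → ℝ := fun i => 1 / ((K + 1) * (i + 1))
  have hK : (0:ℝ) ≤ K := K.2
  have hv : Function.Injective v := by
    intro i j hij
    simp only [v, one_div, inv_inj] at hij
    have := mul_left_cancel₀ (by positivity) hij
    exact_mod_cast add_right_cancel this
  have hv0 : ∀ i, 0 ≤ v i := fun i => by simp only [v]; positivity
  have hv1 : ∀ i, v i * K < 1 := fun i => by
    simp only [v]
    rw [one_div_mul_eq_div, div_lt_one (by positivity)]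
    nlinarith [Nat.cast_nonneg (α := ℝ) i, mul_nonneg hK (Nat.cast_nonneg (α := ℝ) i)]
  have hs := fun i => small_t μ g K hg hout hd (v i) (hv0 i) (hv1 i)
  simp_rw [fun x => det_interp v hv (fderiv ℝ g x)]
  rw [integral_finsetSum _ (fun i _ => (hs i).1.const_mul _)]
  simp_rw [integral_const_mul, fun i => (hs i).2]
  rw [← Finset.sum_mul, ← Polynomial.eval_finsetSum, Lagrange.sum_basis hv.injOn (by simp)]
  simp


lemma no_nonvanishing (h : E → E) (hc : Continuous h) (h0 : ∀ x, h x ≠ 0)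
    (hid : ∀ x, 1 / 2 ≤ ‖x‖ → h x = x) : False := by
  obtain ⟨q, hq, hqh, hqS, -⟩ := hc.exists_contDiff_approx_and_eqOn 1 (ε := fun x => ‖h x‖)
    hc.norm (fun x => norm_pos_iff.2 (h0 x)) (S := {x | 3 / 4 ≤ ‖x‖}) (U := {x | 1 / 2 < ‖x‖})
    (isClosed_le continuous_const continuous_norm)
    ((isOpen_lt continuous_const continuous_norm).mem_nhdsSet.2 (fun x hx => by
      simp only [mem_ofPred_eq] at hx ⊢; linarith))
    (contDiff_id.contDiffOn.congr (fun x hx => hid x (le_of_lt hx)))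
  have hq0 : ∀ x, q x ≠ 0 := by
    intro x hx
    have := hqh x
    simp [hx] at this
  have hqid : ∀ x, 3 / 4 ≤ ‖x‖ → q x = x := fun x hx => by
    rw [hqS hx]; exact hid x (by linarith)
  let r : E → E := fun x => ‖q x‖⁻¹ • q x
  have hr : ContDiff ℝ 1 r := ((hq.norm ℝ hq0).inv (fun x => norm_ne_zero_iff.2 (hq0 x))).smul hq
  have hr1 : ∀ x, ‖r x‖ = 1 := fun x => by
    simp only [r, norm_smul, norm_inv, norm_norm]
    exact inv_mul_cancel₀ (norm_ne_zero_iff.2 (hq0 x))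
  have hrs : ∀ x, ‖x‖ = 1 → r x = x := fun x hx => by
    simp only [r, hqid x (by rw [hx]; norm_num), hx]; simp
  let k : E → E := fun x => r x - x
  have hk : ContDiff ℝ 1 k := hr.sub contDiff_id
  obtain ⟨K, hK⟩ := hk.contDiffOn.exists_lipschitzOnWith one_ne_zero
    (convex_closedBall (0:E) 1) (isCompact_closedBall _ _)
  classical
  let g : E → E := fun x => if ‖x‖ < 1 then k x else 0
  have hgk : ∀ x, ‖x‖ ≤ 1 → g x = k x := by
    intro x hx
    simp only [g]
    split_ifs with h1
    · rfl
    · simp [k, hrs x (le_antisymm hx (not_lt.1 h1))]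
  have hout : ∀ x, 1 ≤ ‖x‖ → g x = 0 := fun x hx => if_neg (not_lt.2 hx)
  have hmix : ∀ x y, ‖x‖ ≤ 1 → 1 ≤ ‖y‖ → ‖g x - g y‖ ≤ K * ‖x - y‖ := by
    intro x y hx hy
    have hcont : ContinuousOn (fun s : ℝ => ‖x + s • (y - x)‖) (Icc 0 1) := by fun_prop
    obtain ⟨s, hs, hs1⟩ := intermediate_value_Icc (zero_le_one' ℝ) hcont
      (show (1:ℝ) ∈ _ from ⟨by simpa using hx, by simpa using hy⟩)
    simp only at hs1
    set z := x + s • (y - x) with hz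
    have hgz : g z = g y := by rw [hout z hs1.ge, hout y hy]
    rw [← hgz, hgk x hx, hgk z hs1.le]
    refine (hK.norm_sub_le (by simpa using hx) (by simpa using hs1.le)).trans ?_
    have : x - z = s • (x - y) := by rw [hz, smul_sub, smul_sub]; abel
    rw [this, norm_smul, Real.norm_of_nonneg hs.1]
    gcongr
    exact mul_le_of_le_one_left (norm_nonneg _) hs.2
  have hg : LipschitzWith K g := by
    apply LipschitzWith.of_dist_le_mul
    intro x y
    rw [dist_eq_norm, dist_eq_norm]
    rcases le_total ‖x‖ 1 with hx | hx <;> rcases le_total ‖y‖ 1 with hy | hy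
    · rw [hgk x hx, hgk y hy]
      exact hK.norm_sub_le (by simpa using hx) (by simpa using hy)
    · exact hmix x y hx hy
    · rw [norm_sub_rev, norm_sub_rev x]; exact hmix y x hy hx
    · rw [hout x hx, hout y hy]; simp; positivity
  have hev : ∀ x ∈ ball (0:E) 1, g =ᶠ[𝓝 x] k := by
    intro x hx
    filter_upwards [isOpen_ball.mem_nhds hx] with z hz
    exact hgk z (by simpa using (mem_ball.1 hz).le)
  have hkd := hk.differentiable one_ne_zero
  have hrd := hr.differentiable one_ne_zero
  have hd : ∀ x ∈ ball (0:E) 1, DifferentiableAt ℝ g x := fun x hx =>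
    (hev x hx).differentiableAt_iff.2 (hkd x)
  have hvol := volume_identity (Measure.addHaar : Measure E) g K hg hout hd
  have hz : ∀ x ∈ ball (0:E) 1, (ContinuousLinearMap.id ℝ E + fderiv ℝ g x).det = 0 := by
    intro x hx
    have h1 : ContinuousLinearMap.id ℝ E + fderiv ℝ g x = fderiv ℝ r x := by
      rw [(hev x hx).fderiv_eq]
      have : fderiv ℝ k x = fderiv ℝ r x - ContinuousLinearMap.id ℝ E := by
        simpa using! ((hrd x).hasFDerivAt.sub (hasFDerivAt_id x)).fderiv
      rw [this]; abel
    rw [h1]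
    by_contra hdet
    have hunit : IsUnit (LinearMap.det (fderiv ℝ r x : E →ₗ[ℝ] E)) := isUnit_iff_ne_zero.2 hdet
    have hsur : Function.Surjective (fderiv ℝ r x) := by
      have := (LinearMap.isUnit_iff_isUnit_det _).2 hunit
      exact ((Module.End.isUnit_iff _).1 this).2
    obtain ⟨v, hv⟩ := hsur (r x)
    have hA := (hrd x).hasFDerivAt.norm_sq
    have hB : HasFDerivAt (fun y => ‖r y‖ ^ 2) (0 : E →L[ℝ] ℝ) x := by
      simp only [hr1]; exact hasFDerivAt_const _ _
    have := congrArg (fun L => L v) (hA.unique hB)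
    simp [hv, hr1] at this
  rw [setIntegral_congr_fun measurableSet_ball hz] at hvol
  have : 0 < (Measure.addHaar : Measure E).real (ball 0 1) :=
    ENNReal.toReal_pos (measure_ball_pos _ _ one_pos).ne' measure_ball_lt_top.ne
  simp at hvol
  linarith

/-- stability of the zero -/
lemma exists_zero (H : E → E) (hc : Continuous H) (hH : ∀ x, ‖x‖ ≤ 1 → ‖H x - x‖ ≤ 1 / 8) :
    ∃ x, ‖x‖ ≤ 1 ∧ H x = 0 := by
  by_contra! hno
  let χ : E → ℝ := fun x => max 0 (min 1 (2 - 4 * ‖x‖))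
  have hχc : Continuous χ := by fun_prop
  refine no_nonvanishing (fun x => x + χ x • (H x - x)) (by fun_prop) ?_ ?_
  · intro x hx
    rcases le_total ‖x‖ (1 / 4) with h | h
    · have : χ x = 1 := by
        simp only [χ]; rw [min_eq_left (by linarith), max_eq_right zero_le_one]
      simp only [this, one_smul, add_sub_cancel] at hx
      exact hno x (by linarith) hx
    · rcases le_total ‖x‖ 1 with h1 | h1
      · have hx' := eq_neg_of_add_eq_zero_left hx
        have h2 : ‖x‖ = χ x * ‖H x - x‖ := by
          conv_lhs => rw [hx']
          rw [norm_neg, norm_smul, Real.norm_of_nonneg (le_max_left _ _)]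
        have h3 : χ x ≤ 1 := max_le zero_le_one (min_le_left _ _)
        nlinarith [hH x h1, norm_nonneg (H x - x)]
      · have : χ x = 0 := by
          simp only [χ]; exact max_eq_left ((min_le_right _ _).trans (by linarith))
        simp only [this, zero_smul, add_zero] at hx
        rw [hx] at h1; simp at h1; linarith
  · intro x hx
    have : χ x = 0 := by
      simp only [χ]; exact max_eq_left ((min_le_right _ _).trans (by linarith))
    simp [this]

lemma core (F : E → E) (hF : ContinuousOn F (closedBall 0 1)) (K : ℝ≥0)
    (hK : ∀ x ∈ closedBall (0:E) 1, ∀ y ∈ closedBall (0:E) 1, ‖x - y‖ ≤ K * ‖F x - F y‖) :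
    F '' closedBall 0 1 ∈ 𝓝 (F 0) := by
  have hinj : InjOn F (closedBall 0 1) := by
    intro x hx y hy h
    have := hK x hx y hy
    rw [h, sub_self, norm_zero, mul_zero] at this
    exact sub_eq_zero.1 (norm_le_zero_iff.1 this)
  have h0mem : (0:E) ∈ closedBall (0:E) 1 := by simp
  -- globally defined Lipschitz left inverse
  obtain ⟨L, G, hG, hGF⟩ : ∃ (L : ℝ≥0) (G : E → E), LipschitzWith L G ∧
      ∀ x ∈ closedBall (0:E) 1, G (F x) = x := by
    have hl : LipschitzOnWith K (Function.invFunOn F (closedBall 0 1)) (F '' closedBall 0 1) := by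
      apply LipschitzOnWith.of_dist_le_mul
      rintro _ ⟨x, hx, rfl⟩ _ ⟨y, hy, rfl⟩
      rw [hinj.leftInvOn_invFunOn hx, hinj.leftInvOn_invFunOn hy, dist_eq_norm, dist_eq_norm]
      exact hK x hx y hy
    obtain ⟨G, hG, hGe⟩ := hl.extend_finite_dimension
    refine ⟨_, G, hG, fun x hx => ?_⟩
    rw [← hGe (mem_image_of_mem F hx), hinj.leftInvOn_invFunOn hx]
  -- continuous extension of `F`
  let π : E → E := fun x => (max 1 ‖x‖)⁻¹ • x
  have hmpos : ∀ x : E, 0 < max 1 ‖x‖ := fun x => lt_of_lt_of_le one_pos (le_max_left _ _)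
  have hπc : Continuous π :=
    (Continuous.inv₀ (by fun_prop) (fun x => (hmpos x).ne')).smul continuous_id
  have hπm : ∀ x, π x ∈ closedBall (0:E) 1 := by
    intro x
    simp only [π, mem_closedBall_zero_iff, norm_smul, norm_inv, Real.norm_of_nonneg (hmpos x).le]
    rw [inv_mul_le_iff₀ (hmpos x), mul_one]
    exact le_max_right _ _
  have hπid : ∀ x, ‖x‖ ≤ 1 → π x = x := by
    intro x hx
    simp [π, max_eq_left hx]
  have hF'c : Continuous (fun x => F (π x)) := hF.comp_continuous hπc hπm
  have hL : (0:ℝ) ≤ L := L.2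
  let ε : ℝ := 1 / (32 * (L + 1))
  have hε : 0 < ε := by positivity
  have hLε : L * ε ≤ 1 / 16 := by
    simp only [ε]
    rw [mul_one_div, div_le_div_iff₀ (by positivity) (by norm_num)]
    linarith
  by_contra hnot
  rw [Metric.mem_nhds_iff] at hnot
  push Not at hnot
  obtain ⟨c, hcb, hcn⟩ := not_subset.1 (hnot ε hε)
  have hc0 : ‖F 0 - c‖ < ε := by rw [norm_sub_rev, ← dist_eq_norm]; exact hcb
  have hcomp : IsCompact (F '' closedBall 0 1 ∩ {y | ε ≤ ‖y - c‖}) :=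
    ((isCompact_closedBall (0:E) 1).image_of_continuousOn hF).inter_right
      (isClosed_le continuous_const (by fun_prop))
  obtain ⟨δ, hδ, hδG⟩ := hcomp.exists_forall_le' (f := fun y => ‖G y‖) (a := 0)
    hG.continuous.norm.continuousOn (by
      rintro _ ⟨⟨x, hx, rfl⟩, hy⟩
      rw [hGF x hx]
      apply norm_pos_iff.2
      rintro rfl
      exact absurd hy (not_le.2 hc0))
  obtain ⟨v, hv, hvs⟩ : ∃ v ∈ ball (0:E) (min δ (1 / 16)), v ∉ G '' sphere c ε := by
    by_contra! hall
    have hsub : ball (0:E) (min δ (1 / 16)) ⊆ G '' sphere c ε := hall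
    have h1 := hG.hausdorffMeasure_image_le (d := Module.finrank ℝ E) (Nat.cast_nonneg _)
      (sphere c ε)
    rw [Measure.addHaar_sphere_of_ne_zero _ _ hε.ne', mul_zero] at h1
    have h2 := (measure_mono hsub).trans h1
    exact (measure_ball_pos (Measure.hausdorffMeasure (Module.finrank ℝ E) : Measure E) 0
      (lt_min hδ (by norm_num))).ne' (le_antisymm h2 bot_le)
  have hv' : ‖v‖ < min δ (1 / 16) := by simpa using hv
  let Φ : E → E := fun y => c + (max 1 (ε / ‖y - c‖)) • (y - c)
  have hne : ∀ x, F (π x) - c ≠ 0 := fun x h => hcn ⟨π x, hπm x, sub_eq_zero.1 h⟩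
  have hΦc : Continuous (fun x => Φ (F (π x))) := by
    simp only [Φ]
    have : Continuous (fun x => ε / ‖F (π x) - c‖) :=
      continuous_const.div (hF'c.sub continuous_const).norm
        (fun x => norm_ne_zero_iff.2 (hne x))
    exact continuous_const.add ((continuous_const.max this).smul (hF'c.sub continuous_const))
  have hfar : ∀ y, ε ≤ ‖y - c‖ → Φ y = y := by
    intro y hy
    simp only [Φ]
    rw [max_eq_left (div_le_one_of_le₀ hy (norm_nonneg _))]
    simp
  have hnear : ∀ y, y - c ≠ 0 → ‖y - c‖ < ε →
      Φ y ∈ sphere c ε ∧ ‖Φ y - y‖ ≤ ε := by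
    intro y hy0 hy
    have hp : 0 < ‖y - c‖ := norm_pos_iff.2 hy0
    have hm : max 1 (ε / ‖y - c‖) = ε / ‖y - c‖ := max_eq_right ((one_le_div hp).2 hy.le)
    constructor
    · simp only [Φ, hm, mem_sphere_iff_norm, add_sub_cancel_left, norm_smul, norm_div, norm_norm,
        Real.norm_of_nonneg hε.le]
      field_simp
    · have : Φ y - y = (ε / ‖y - c‖ - 1) • (y - c) := by
        simp only [Φ, hm, sub_smul, one_smul]; abel
      rw [this, norm_smul, Real.norm_of_nonneg (sub_nonneg.2 ((one_le_div hp).2 hy.le)), sub_mul,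
        div_mul_cancel₀ _ hp.ne']
      linarith
  have hΦd : ∀ x, ‖Φ (F (π x)) - F (π x)‖ ≤ ε := by
    intro x
    rcases le_or_gt ε ‖F (π x) - c‖ with h | h
    · rw [hfar _ h]; simpa using hε.le
    · exact (hnear _ (hne x) h).2
  obtain ⟨x, hx, hHx⟩ := exists_zero (fun x => G (Φ (F (π x))) - v)
    ((hG.continuous.comp hΦc).sub continuous_const) (by
      intro x hx
      have h1 : G (F (π x)) = x := by rw [hπid x hx]; exact hGF x (by simpa using hx)
      have h2 := hG.norm_sub_le (Φ (F (π x))) (F (π x))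
      rw [h1] at h2
      have h3 := mul_le_mul_of_nonneg_left (hΦd x) hL
      have h4 : ‖v‖ ≤ 1 / 16 := hv'.le.trans (min_le_right _ _)
      calc ‖G (Φ (F (π x))) - v - x‖ = ‖(G (Φ (F (π x))) - x) - v‖ := by congr 1; abel
        _ ≤ ‖G (Φ (F (π x))) - x‖ + ‖v‖ := norm_sub_le _ _
        _ ≤ 1 / 8 := by linarith)
  have hGv : G (Φ (F (π x))) = v := sub_eq_zero.1 hHx
  rcases le_or_gt ε ‖F (π x) - c‖ with h | h
  · have h1 := hδG _ ⟨mem_image_of_mem F (hπm x), h⟩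
    rw [hfar _ h] at hGv
    simp only [hGv] at h1
    exact absurd h1 (not_le.2 (hv'.trans_le (min_le_left _ _)))
  · exact hvs ⟨_, (hnear _ (hne x) h).1, hGv⟩


lemma local_open {X Y : Type*} [NormedAddCommGroup X] [NormedSpace ℝ X]
    [NormedAddCommGroup Y] [NormedSpace ℝ Y]
    [FiniteDimensional ℝ X] [FiniteDimensional ℝ Y]
    (hdim : Module.finrank ℝ X = Module.finrank ℝ Y) (F : X → Y) (x : X) (s : Set X)
    (hs : s ∈ 𝓝 x) (hF : ContinuousOn F s) (S : ℝ) (hS : 0 ≤ S)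
    (hst : ∀ a ∈ s, ∀ b ∈ s, ‖a - b‖ ≤ S * ‖F a - F b‖) : F '' s ∈ 𝓝 (F x) := by
  let E := EuclideanSpace ℝ (Fin (Module.finrank ℝ X))
  let eX : X ≃L[ℝ] E := ContinuousLinearEquiv.ofFinrankEq (by simp [E])
  let eY : Y ≃L[ℝ] E := ContinuousLinearEquiv.ofFinrankEq (by simp [E, hdim])
  have hpre : (fun w : E => x + eX.symm w) ⁻¹' s ∈ 𝓝 (0:E) := by
    apply (show Continuous (fun w : E => x + eX.symm w) by fun_prop).continuousAt
    simpa using hs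
  obtain ⟨δ, hδ, hδs⟩ := Metric.nhds_basis_closedBall.mem_iff.1 hpre
  let φ : E → X := fun z => x + eX.symm (δ • z)
  have hφc : Continuous φ := by fun_prop
  have hφs : ∀ z ∈ closedBall (0:E) 1, φ z ∈ s := by
    intro z hz
    apply hδs
    rw [mem_closedBall_zero_iff] at hz ⊢
    rw [norm_smul, Real.norm_of_nonneg hδ.le]
    exact mul_le_of_le_one_right hδ.le hz
  have hφ0 : φ 0 = x := by simp [φ]
  let C : ℝ := δ⁻¹ * (‖(eX : X →L[ℝ] E)‖ * (S * ‖(eY.symm : E →L[ℝ] Y)‖))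
  have hC : 0 ≤ C := by positivity
  have hmain := core (fun z => eY (F (φ z)))
    (eY.continuous.comp_continuousOn (hF.comp hφc.continuousOn hφs)) C.toNNReal (by
      intro z hz w hw
      rw [Real.coe_toNNReal C hC]
      have h1 : z - w = δ⁻¹ • eX (φ z - φ w) := by
        simp only [φ, add_sub_add_left_eq_sub, map_sub, ContinuousLinearEquiv.apply_symm_apply,
          ← smul_sub]
        rw [smul_smul, inv_mul_cancel₀ hδ.ne', one_smul]
      have h2 : F (φ z) - F (φ w) = eY.symm (eY (F (φ z)) - eY (F (φ w))) := by simp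
      have h3 : ‖F (φ z) - F (φ w)‖ ≤
          ‖(eY.symm : E →L[ℝ] Y)‖ * ‖eY (F (φ z)) - eY (F (φ w))‖ := by
        conv_lhs => rw [h2]
        exact (eY.symm : E →L[ℝ] Y).le_opNorm _
      have h4 : ‖eX (φ z - φ w)‖ ≤ ‖(eX : X →L[ℝ] E)‖ * ‖φ z - φ w‖ :=
        (eX : X →L[ℝ] E).le_opNorm _
      rw [h1, norm_smul, norm_inv, Real.norm_of_nonneg hδ.le]
      calc δ⁻¹ * ‖eX (φ z - φ w)‖ ≤ δ⁻¹ * (‖(eX : X →L[ℝ] E)‖ * (S *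
            (‖(eY.symm : E →L[ℝ] Y)‖ * ‖eY (F (φ z)) - eY (F (φ w))‖))) := by
            gcongr
            refine h4.trans ?_
            gcongr
            refine (hst _ (hφs z hz) _ (hφs w hw)).trans ?_
            gcongr
        _ = C * ‖eY (F (φ z)) - eY (F (φ w))‖ := by simp only [C]; ring)
  simp only [hφ0] at hmain
  have := eY.continuous.continuousAt hmain
  filter_upwards [this] with y hy
  obtain ⟨z, hz, hzy⟩ := hy
  exact ⟨φ z, hφs z hz, eY.injective hzy⟩

end StetterAux

/-- Stetter's inverse-mapping stability lemma (Lemma 8 of the paper). -/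
theorem stetter_inverse_mapping
    (X Y : Type*) [NormedAddCommGroup X] [NormedSpace ℝ X]
    [NormedAddCommGroup Y] [NormedSpace ℝ Y]
    [FiniteDimensional ℝ X] [FiniteDimensional ℝ Y]
    (hdim : Module.finrank ℝ X = Module.finrank ℝ Y)
    (x_u : X) (r₁ S r₂ : ℝ) (hr₁ : 0 < r₁) (hS : 0 < S) (hr₂ : 0 < r₂)
    (F : X → Y) (hF : ContinuousOn F (Metric.ball x_u r₁))
    (hstab : ∀ x₁ ∈ Metric.ball x_u r₁, ∀ x₂ ∈ Metric.ball x_u r₁,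
      ‖F x₁ - F x_u‖ ≤ r₂ → ‖F x₂ - F x_u‖ ≤ r₂ →
        ‖x₁ - x₂‖ ≤ S * ‖F x₁ - F x₂‖) :
    ∃ G : Y → X,
      (∀ y ∈ Metric.ball (F x_u) (min r₂ (r₁ / S)),
        G y ∈ Metric.ball x_u r₁ ∧ F (G y) = y) ∧
      (∀ y₁ ∈ Metric.ball (F x_u) (min r₂ (r₁ / S)),
        ∀ y₂ ∈ Metric.ball (F x_u) (min r₂ (r₁ / S)),
          ‖G y₁ - G y₂‖ ≤ S * ‖y₁ - y₂‖) := by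
  have hsub : ball (F x_u) (min r₂ (r₁ / S)) ⊆
      ball (F x_u) (min r₂ (r₁ / S)) ∩ F '' ball x_u r₁ := by
    have hxu : x_u ∈ ball x_u r₁ := mem_ball_self hr₁
    have hr0 : 0 < min r₂ (r₁ / S) := lt_min hr₂ (div_pos hr₁ hS)
    have hlt2 : ∀ y ∈ ball (F x_u) (min r₂ (r₁ / S)), ‖y - F x_u‖ < r₂ := fun y hy =>
      (mem_ball_iff_norm.1 hy).trans_le (min_le_left _ _)
    apply IsPreconnected.subset_of_closure_inter_subset (convex_ball _ _).isPreconnected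
    · rw [isOpen_iff_mem_nhds]
      rintro _ ⟨hyV, x, hx, rfl⟩
      refine inter_mem (isOpen_ball.mem_nhds hyV) ?_
      have hs : ball x_u r₁ ∩ F ⁻¹' ball (F x_u) r₂ ∈ 𝓝 x :=
        (hF.isOpen_inter_preimage isOpen_ball isOpen_ball).mem_nhds
          ⟨hx, mem_ball_iff_norm.2 (hlt2 _ hyV)⟩
      refine mem_of_superset (StetterAux.local_open hdim F x _ hs (hF.mono inter_subset_left) S hS.le
        ?_) (image_mono inter_subset_left)
      rintro a ⟨ha, ha2⟩ b ⟨hb, hb2⟩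
      exact hstab a ha b hb (mem_ball_iff_norm.1 ha2).le (mem_ball_iff_norm.1 hb2).le
    · exact ⟨F x_u, mem_ball_self hr0, mem_ball_self hr0, x_u, hxu, rfl⟩
    · rintro y ⟨hyc, hyV⟩
      refine ⟨hyV, ?_⟩
      obtain ⟨u, hu, huy⟩ := mem_closure_iff_seq_limit.1 hyc
      choose huV x hx hxu' using hu
      have hb : ∀ m n, ‖x m - x n‖ ≤ S * ‖u m - u n‖ := by
        intro m n
        have := hstab _ (hx m) _ (hx n) (by rw [hxu' m]; exact (hlt2 _ (huV m)).le)
          (by rw [hxu' n]; exact (hlt2 _ (huV n)).le)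
        rwa [hxu' m, hxu' n] at this
      have hcx : CauchySeq x := by
        have huC := huy.cauchySeq
        rw [Metric.cauchySeq_iff] at huC ⊢
        intro ε hε
        obtain ⟨N, hN⟩ := huC (ε / S) (div_pos hε hS)
        refine ⟨N, fun m hm n hn => ?_⟩
        have h1 := hN m hm n hn
        rw [dist_eq_norm] at h1 ⊢
        refine (hb m n).trans_lt ?_
        rwa [lt_div_iff₀ hS, mul_comm] at h1
      haveI : CompleteSpace X := FiniteDimensional.complete ℝ X
      obtain ⟨z, hz⟩ := cauchySeq_tendsto_of_complete hcx
      have hzb : ‖z - x_u‖ ≤ S * ‖y - F x_u‖ := by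
        refine le_of_tendsto_of_tendsto' (hz.sub_const x_u).norm
          ((huy.sub_const (F x_u)).norm.const_mul S) (fun n => ?_)
        have := hstab _ (hx n) _ hxu (by rw [hxu' n]; exact (hlt2 _ (huV n)).le)
          (by simpa using hr₂.le)
        rwa [hxu' n] at this
      have hzB : z ∈ ball x_u r₁ := by
        rw [mem_ball_iff_norm]
        refine hzb.trans_lt ?_
        have := (mem_ball_iff_norm.1 hyV).trans_le (min_le_right _ _)
        rwa [lt_div_iff₀ hS, mul_comm] at this
      refine ⟨z, hzB, ?_⟩
      have h1 : Tendsto (fun n => F (x n)) atTop (𝓝 (F z)) :=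
        ((hF.continuousAt (isOpen_ball.mem_nhds hzB)).tendsto).comp hz
      simp only [hxu'] at h1
      exact tendsto_nhds_unique h1 huy
  have hex : ∀ y, ∃ x, y ∈ ball (F x_u) (min r₂ (r₁ / S)) → x ∈ ball x_u r₁ ∧ F x = y := by
    intro y
    by_cases hy : y ∈ ball (F x_u) (min r₂ (r₁ / S))
    · obtain ⟨-, x, hx, hxy⟩ := hsub hy
      exact ⟨x, fun _ => ⟨hx, hxy⟩⟩
    · exact ⟨0, fun h => absurd h hy⟩
  choose G hG using hex
  refine ⟨G, hG, fun y₁ h₁ y₂ h₂ => ?_⟩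
  have := hstab _ (hG y₁ h₁).1 _ (hG y₂ h₂).1
    (by rw [(hG y₁ h₁).2]; exact ((mem_ball_iff_norm.1 h₁).trans_le (min_le_left _ _)).le)
    (by rw [(hG y₂ h₂).2]; exact ((mem_ball_iff_norm.1 h₂).trans_le (min_le_left _ _)).le)
  rwa [(hG y₁ h₁).2, (hG y₂ h₂).2] at this
end

section
/- Let H be a real Hilbert space, let a < b be real numbers, and let g : [a, b] → H be continuously differentiable. Then ‖∫_a^b g(t) dt − (b − a)·g(a)‖² ≤ (1/2)·(b − a)³·∫_a^b ‖g′(s)‖² ds, where the integral of g is the Bochner integral and ‖·‖ is the norm of H. -/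
/-- One-interval left-endpoint quadrature error estimate for Hilbert-space-valued
functions: `‖∫_a^b g − (b−a) g(a)‖² ≤ (1/2)(b−a)³ ∫_a^b ‖g′‖²`. -/
theorem left_endpoint_quadrature_error
    (H : Type*) [NormedAddCommGroup H] [InnerProductSpace ℝ H] [CompleteSpace H]
    (a b : ℝ) (hab : a < b) (g g' : ℝ → H)
    (hg : ∀ t ∈ Set.Icc a b, HasDerivWithinAt g (g' t) (Set.Icc a b) t)
    (hg' : ContinuousOn g' (Set.Icc a b)) :
    ‖(∫ t in a..b, g t) - (b - a) • g a‖ ^ 2 ≤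
      (1 / 2) * (b - a) ^ 3 * ∫ s in a..b, ‖g' s‖ ^ 2 := by
  have hu : Set.uIcc a b = Set.Icc a b := Set.uIcc_of_le hab.le
  have hw : ContinuousOn (fun t : ℝ => b - t) (Set.uIcc a b) := by fun_prop
  have hn : ContinuousOn (fun t => ‖g' t‖) (Set.uIcc a b) := by rw [hu]; exact hg'.norm
  have hE : (∫ t in a..b, g t) - (b - a) • g a = ∫ t in a..b, (b - t) • g' t := by
    have h := intervalIntegral.integral_smul_deriv_eq_deriv_smul_of_hasDerivWithinAt
      (a := a) (b := b) (u := fun t : ℝ => b - t) (u' := fun _ => (-1 : ℝ)) (v := g) (v' := g')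
      (fun t _ => by simpa using ((hasDerivAt_id t).const_sub b).hasDerivWithinAt)
      (by rw [hu]; exact hg) (by simp)
      (by apply ContinuousOn.intervalIntegrable; rw [hu]; exact hg')
    rw [h]
    simp
    abel
  have hJ : ‖∫ t in a..b, (b - t) • g' t‖ ≤ ∫ t in a..b, (b - t) * ‖g' t‖ := by
    refine (intervalIntegral.norm_integral_le_integral_norm hab.le).trans (le_of_eq ?_)
    apply intervalIntegral.integral_congr
    intro t ht
    rw [hu] at ht
    simp only [norm_smul, Real.norm_eq_abs]
    rw [abs_of_nonneg (by linarith [ht.2])]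
  rw [hE]
  set J := ∫ t in a..b, (b - t) * ‖g' t‖ with hJdef
  set S := ∫ s in a..b, ‖g' s‖ ^ 2 with hS
  have hW : ∫ t in a..b, (b - t) ^ 2 = (b - a) ^ 3 / 3 := by
    rw [intervalIntegral.integral_comp_sub_left (fun x => x ^ 2) b, integral_pow]
    norm_num
  have hL : 0 < (b - a) ^ 3 := pow_pos (by linarith) 3
  have key : ∀ c : ℝ, 0 ≤ S - 2 * c * J + c ^ 2 * ((b - a) ^ 3 / 3) := by
    intro c
    have h0 : 0 ≤ ∫ t in a..b, (‖g' t‖ - c * (b - t)) ^ 2 :=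
      intervalIntegral.integral_nonneg hab.le (fun t _ => sq_nonneg _)
    have h1 : ∫ t in a..b, (‖g' t‖ - c * (b - t)) ^ 2
        = ∫ t in a..b, (‖g' t‖ ^ 2 - 2 * c * ((b - t) * ‖g' t‖) + c ^ 2 * (b - t) ^ 2) := by
      congr 1; ext t; ring
    have i1 : IntervalIntegrable (fun t => ‖g' t‖ ^ 2) MeasureTheory.volume a b :=
      (hn.pow 2).intervalIntegrable (μ := MeasureTheory.volume)
    have i2 : IntervalIntegrable (fun t => 2 * c * ((b - t) * ‖g' t‖)) MeasureTheory.volume a b :=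
      ((hw.mul hn).intervalIntegrable (μ := MeasureTheory.volume)).const_mul (2 * c)
    have i3 : IntervalIntegrable (fun t => c ^ 2 * (b - t) ^ 2) MeasureTheory.volume a b :=
      ((hw.pow 2).intervalIntegrable (μ := MeasureTheory.volume)).const_mul (c ^ 2)
    rw [h1, intervalIntegral.integral_add (i1.sub i2) i3, intervalIntegral.integral_sub i1 i2,
      intervalIntegral.integral_const_mul, intervalIntegral.integral_const_mul, hW] at h0
    exact h0
  have hS0 : 0 ≤ S := intervalIntegral.integral_nonneg hab.le (fun t _ => sq_nonneg _)
  have hk := key (3 * J / (b - a) ^ 3)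
  have e : S - 2 * (3 * J / (b - a) ^ 3) * J + (3 * J / (b - a) ^ 3) ^ 2 * ((b - a) ^ 3 / 3)
      = S - 3 * J ^ 2 / (b - a) ^ 3 := by
    generalize (b - a) ^ 3 = L at hL
    field_simp
    ring
  rw [e, sub_nonneg, div_le_iff₀ hL] at hk
  have h2 : ‖∫ t in a..b, (b - t) • g' t‖ ^ 2 ≤ J ^ 2 :=
    pow_le_pow_left₀ (norm_nonneg _) hJ 2
  nlinarith [mul_nonneg hS0 hL.le]
end
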